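/- arXiv:1005.3845 — 2 statements merged into one kernel-verified Lean document; each statement's English description precedes it below -/
import Mathlib

section
/- Let k ≥ 2 and d ≥ 1 be integers, and let A_1, …, A_k be invertible d×d complex matrices satisfying the ellipticity condition. For every integer m ≥ 2, P_m is the orthogonal direct sum, with respect to the Fischer inner product, of H_m = P_m ∩ ker Δ and B(x)·P_{m−2}; consequently P_m decomposes as the direct sum P_m = ⊕_{j=0}^{⌊m/2⌋} B(x)^j · H_{m−2j}. -/
open MvPolynomial Matrix

noncomputable section

abbrev VPoly (k d : ℕ) := Fin d → MvPolynomial (Fin k) ℂ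

def IsHomV {k d : ℕ} (m : ℕ) (p : VPoly k d) : Prop := ∀ r, (p r).IsHomogeneous m

def elliptic {k d : ℕ} (A : Fin k → Matrix (Fin d) (Fin d) ℂ) : Prop :=
  ∀ c : Fin k → ℝ, (∑ j, (c j : ℂ) • A j).det = 0 → c = 0

def DeltaOp {k d : ℕ} (A : Fin k → Matrix (Fin d) (Fin d) ℂ) :
    VPoly k d →ₗ[ℂ] VPoly k d :=
  LinearMap.pi fun r =>
    - ∑ i, ∑ j, ∑ s, ((A i)ᴴ * A j) r s •
        ((pderiv i).toLinearMap ∘ₗ (pderiv j).toLinearMap ∘ₗ LinearMap.proj s)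

def BOp {k d : ℕ} (A : Fin k → Matrix (Fin d) (Fin d) ℂ) :
    VPoly k d →ₗ[ℂ] VPoly k d :=
  LinearMap.pi fun r =>
    - ∑ i, ∑ j, ∑ s, ((A i)ᴴ * A j) r s •
        ((LinearMap.mulLeft ℂ (X i * X j)) ∘ₗ LinearMap.proj s)

def LOp {k d : ℕ} (A : Fin k → Matrix (Fin d) (Fin d) ℂ) :
    VPoly k d →ₗ[ℂ] VPoly k d :=
  LinearMap.pi fun r =>
    (∑ j, ∑ l, ∑ s, ((A l)ᴴ * A j) r s •
        ((LinearMap.mulLeft ℂ (X l)) ∘ₗ (pderiv j).toLinearMap ∘ₗ LinearMap.proj s))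
    - ∑ j, (LinearMap.mulLeft ℂ (X j)) ∘ₗ (pderiv j).toLinearMap ∘ₗ LinearMap.proj r

def PmSub (k d m : ℕ) : Submodule ℂ (VPoly k d) :=
  Submodule.pi Set.univ fun _ : Fin d => homogeneousSubmodule (Fin k) ℂ m

def HmSub {k d : ℕ} (A : Fin k → Matrix (Fin d) (Fin d) ℂ) (m : ℕ) :
    Submodule ℂ (VPoly k d) :=
  PmSub k d m ⊓ LinearMap.ker (DeltaOp A)

def fischer {k d : ℕ} (p q : VPoly k d) : ℂ :=
  ∑ r, ∑ α ∈ (p r).support,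
    (∏ i, (Nat.factorial (α i) : ℂ)) * coeff α (p r) * (starRingEnd ℂ) (coeff α (q r))

section FischerDecomposition

variable {k d : ℕ}

/-- The Fischer pairing of scalar polynomials against `q`, as a linear functional. -/
def fischerFunctional (q : MvPolynomial (Fin k) ℂ) : MvPolynomial (Fin k) ℂ →ₗ[ℂ] ℂ :=
  (basisMonomials (Fin k) ℂ).constr ℂ fun α =>
    (∏ i, (Nat.factorial (α i) : ℂ)) * (starRingEnd ℂ) (coeff α q)

lemma fischerFunctional_monomial (q : MvPolynomial (Fin k) ℂ) (α : Fin k →₀ ℕ) (c : ℂ) :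
    fischerFunctional q (monomial α c) =
      (∏ i, (Nat.factorial (α i) : ℂ)) * c * (starRingEnd ℂ) (coeff α q) := by
  have h : monomial α c = c • basisMonomials (Fin k) ℂ α := by
    simp [smul_monomial]
  rw [h, map_smul, fischerFunctional, Module.Basis.constr_basis, smul_eq_mul]
  ring

lemma fischerFunctional_apply (p q : MvPolynomial (Fin k) ℂ) :
    fischerFunctional q p = ∑ α ∈ p.support,
      (∏ i, (Nat.factorial (α i) : ℂ)) * coeff α p * (starRingEnd ℂ) (coeff α q) := by
  conv_lhs => rw [p.as_sum, map_sum]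
  simp_rw [fischerFunctional_monomial]

lemma fischer_eq_sum_fischerFunctional (p q : VPoly k d) :
    fischer p q = ∑ r, fischerFunctional (q r) (p r) := by
  simp_rw [fischer, fischerFunctional_apply]

lemma fischerFunctional_smul_right (c : ℂ) (p q : MvPolynomial (Fin k) ℂ) :
    fischerFunctional (c • q) p = starRingEnd ℂ c * fischerFunctional q p := by
  simp_rw [fischerFunctional_apply, coeff_smul, smul_eq_mul, map_mul, Finset.mul_sum]
  exact Finset.sum_congr rfl fun _ _ => by ring

lemma fischerFunctional_neg_right (p q : MvPolynomial (Fin k) ℂ) :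
    fischerFunctional (-q) p = -fischerFunctional q p := by
  simpa using fischerFunctional_smul_right (-1) p q

lemma fischerFunctional_sum_right {ι : Type*} (s : Finset ι) (p : MvPolynomial (Fin k) ℂ)
    (q : ι → MvPolynomial (Fin k) ℂ) :
    fischerFunctional (∑ i ∈ s, q i) p = ∑ i ∈ s, fischerFunctional (q i) p := by
  simp_rw [fischerFunctional_apply, coeff_sum, map_sum, Finset.mul_sum]
  exact Finset.sum_comm

/-- Multiplication by a variable is adjoint to the partial derivative. -/
lemma fischerFunctional_pderiv (i : Fin k) (p q : MvPolynomial (Fin k) ℂ) :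
    fischerFunctional q (pderiv i p) = fischerFunctional (X i * q) p := by
  induction p using MvPolynomial.induction_on' with
  | add p p' hp hp' => simp [hp, hp']
  | monomial α c =>
    rw [pderiv_monomial, fischerFunctional_monomial, fischerFunctional_monomial, coeff_X_mul']
    by_cases hα : α i = 0
    · simp [hα]
    · rw [if_pos (by simpa using hα)]
      have h : ((α i).factorial : ℂ) = α i * ((α i - 1).factorial : ℂ) := by
        exact_mod_cast (Nat.mul_factorial_pred hα).symm
      rw [← Finset.mul_prod_erase _ _ (Finset.mem_univ i),
        ← Finset.mul_prod_erase _ (fun j => ((α j).factorial : ℂ)) (Finset.mem_univ i),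
        Finset.prod_congr rfl (g := fun j => ((α j).factorial : ℂ))
          fun j hj => by simp [Finsupp.single_eq_of_ne (Finset.ne_of_mem_erase hj)], h]
      simp only [Finsupp.coe_tsub, Pi.sub_apply, Finsupp.single_eq_same]
      ring

open scoped ComplexOrder in
lemma eq_zero_of_fischer_self {p : VPoly k d} (hp : fischer p p = 0) : p = 0 := by
  have hnn : ∀ r, ∀ α ∈ (p r).support, 0 ≤
      (∏ i, (Nat.factorial (α i) : ℂ)) * coeff α (p r) * (starRingEnd ℂ) (coeff α (p r)) := by
    intro r α _
    rw [mul_assoc]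
    refine mul_nonneg (Finset.prod_nonneg fun i _ => Nat.cast_nonneg _) ?_
    exact mul_star_self_nonneg _
  funext r
  rw [fischer, Finset.sum_eq_zero_iff_of_nonneg fun r _ => Finset.sum_nonneg (hnn r)] at hp
  have h := hp r (Finset.mem_univ r)
  rw [Finset.sum_eq_zero_iff_of_nonneg (hnn r)] at h
  ext α
  by_contra hα
  have := h α (mem_support_iff.mpr hα)
  simp only [mul_eq_zero, Finset.prod_eq_zero_iff, map_eq_zero, Nat.cast_eq_zero,
    Nat.factorial_ne_zero, and_false, exists_false, false_or, or_self] at this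
  exact hα this

lemma DeltaOp_apply (A : Fin k → Matrix (Fin d) (Fin d) ℂ) (p : VPoly k d) (r : Fin d) :
    DeltaOp A p r = -∑ i, ∑ j, ∑ s, ((A i)ᴴ * A j) r s • pderiv i (pderiv j (p s)) := by
  simp [DeltaOp, LinearMap.sum_apply]

lemma BOp_apply (A : Fin k → Matrix (Fin d) (Fin d) ℂ) (p : VPoly k d) (r : Fin d) :
    BOp A p r = -∑ i, ∑ j, ∑ s, ((A i)ᴴ * A j) r s • (X i * X j * p s) := by
  simp [BOp, LinearMap.sum_apply, mul_assoc]

/-- Multiplication by `B` is adjoint to `Δ` for the Fischer inner product. -/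
lemma fischer_BOp_right (A : Fin k → Matrix (Fin d) (Fin d) ℂ) (p q : VPoly k d) :
    fischer p (BOp A q) = fischer (DeltaOp A p) q := by
  have hconj : ∀ i j r s, starRingEnd ℂ (((A i)ᴴ * A j) s r) = ((A j)ᴴ * A i) r s := by
    intro i j r s
    rw [← conjTranspose_conjTranspose (A i), ← conjTranspose_mul, conjTranspose_apply]
    simp
  simp_rw [fischer_eq_sum_fischerFunctional, BOp_apply, DeltaOp_apply, map_neg, map_sum, map_smul,
    fischerFunctional_neg_right, fischerFunctional_sum_right, fischerFunctional_smul_right,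
    fischerFunctional_pderiv, hconj, smul_eq_mul, Finset.sum_neg_distrib]
  congr 1
  simp_rw [← Fintype.sum_prod_type']
  refine Fintype.sum_equiv
    ⟨fun x => (x.2.2.2, x.2.2.1, x.2.1, x.1), fun x => (x.2.2.2, x.2.2.1, x.2.1, x.1),
      fun _ => rfl, fun _ => rfl⟩ _ _ fun x => ?_
  rw [mul_assoc]
  rfl

lemma IsHomV.BOp {n : ℕ} {p : VPoly k d} (hp : IsHomV n p)
    (A : Fin k → Matrix (Fin d) (Fin d) ℂ) : IsHomV (n + 2) (BOp A p) := by
  intro r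
  rw [BOp_apply, ← mem_homogeneousSubmodule]
  refine neg_mem (sum_mem fun i _ => sum_mem fun j _ => sum_mem fun s _ =>
    Submodule.smul_mem _ _ ?_)
  rw [mem_homogeneousSubmodule, add_comm]
  exact ((isHomogeneous_X ℂ i).mul (isHomogeneous_X ℂ j)).mul (hp s)

lemma IsHomV.DeltaOp {n : ℕ} {p : VPoly k d} (hp : IsHomV n p)
    (A : Fin k → Matrix (Fin d) (Fin d) ℂ) : IsHomV (n - 2) (DeltaOp A p) := by
  intro r
  rw [DeltaOp_apply, ← mem_homogeneousSubmodule]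
  refine neg_mem (sum_mem fun i _ => sum_mem fun j _ => sum_mem fun s _ =>
    Submodule.smul_mem _ _ ?_)
  rw [mem_homogeneousSubmodule]
  exact (hp s).pderiv.pderiv

lemma DeltaOp_eq_zero_of_isHomV {n : ℕ} (hn : n < 2) {p : VPoly k d} (hp : IsHomV n p)
    (A : Fin k → Matrix (Fin d) (Fin d) ℂ) : DeltaOp A p = 0 := by
  funext r
  rw [DeltaOp_apply, Pi.zero_apply, neg_eq_zero]
  refine Finset.sum_eq_zero fun i _ => Finset.sum_eq_zero fun j _ =>
    Finset.sum_eq_zero fun s _ => ?_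
  have h : (pderiv j (p s)).IsHomogeneous 0 := by
    simpa [Nat.sub_eq_zero_of_le (Nat.le_of_lt_succ hn)] using (hp s).pderiv (i := j)
  rw [totalDegree_eq_zero_iff_eq_C.mp (Nat.le_zero.mp h.totalDegree_le), pderiv_C, smul_zero]

/-- Pointwise at a real vector, `B(x) = -S(x)ᴴ S(x)` with `S(x) = ∑ xⱼ Aⱼ`. -/
lemma eval_BOp (A : Fin k → Matrix (Fin d) (Fin d) ℂ) (q : VPoly k d) (c : Fin k → ℝ) :
    (fun r => eval (fun i => (c i : ℂ)) (BOp A q r)) =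
      -(((∑ j, (c j : ℂ) • A j)ᴴ * ∑ j, (c j : ℂ) • A j) *ᵥ
        fun r => eval (fun i => (c i : ℂ)) (q r)) := by
  funext r
  simp only [BOp_apply, map_neg, map_sum, smul_eval, map_mul, eval_X, Pi.neg_apply,
    conjTranspose_sum, conjTranspose_smul, Finset.sum_mul, Finset.mul_sum, Matrix.sum_mulVec,
    Finset.sum_apply, Matrix.smul_mul, Matrix.mul_smul, Matrix.smul_mulVec, Pi.smul_apply,
    smul_eq_mul, Matrix.mulVec, dotProduct, Complex.star_def, Complex.conj_ofReal]
  congr 1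
  conv_rhs => rw [Finset.sum_comm]
  exact Finset.sum_congr rfl fun _ _ => Finset.sum_congr rfl fun _ _ =>
    Finset.sum_congr rfl fun _ _ => by ring

lemma BOp_injective (hk : 0 < k) {A : Fin k → Matrix (Fin d) (Fin d) ℂ} (hell : elliptic A) :
    Function.Injective (BOp A) := by
  rw [injective_iff_map_eq_zero]
  intro q hq
  funext r
  refine funext_set (fun _ => (fun x : ℝ => (x : ℂ)) '' {0}ᶜ)
    (fun _ => (Set.finite_singleton (0 : ℝ)).infinite_compl.image
      Complex.ofReal_injective.injOn) fun x hx => ?_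
  choose c hc hcx using fun i => hx i trivial
  obtain rfl : (fun i => (c i : ℂ)) = x := funext hcx
  have hdet : (∑ j, (c j : ℂ) • A j).det ≠ 0 := fun h =>
    hc ⟨0, hk⟩ (congrFun (hell c h) ⟨0, hk⟩)
  have hdet' : ((∑ j, (c j : ℂ) • A j)ᴴ * ∑ j, (c j : ℂ) • A j).det ≠ 0 := by
    simpa [det_mul, det_conjTranspose] using hdet
  have h := eval_BOp A q c
  rw [hq, eq_comm, neg_eq_iff_eq_neg] at h
  simpa using congrFun (Matrix.eq_zero_of_mulVec_eq_zero hdet' (h.trans (by ext; simp))) r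

lemma mem_PmSub {n : ℕ} {p : VPoly k d} : p ∈ PmSub k d n ↔ IsHomV n p := by
  simp [PmSub, IsHomV, Submodule.mem_pi]

instance finite_PmSub (n : ℕ) : Module.Finite ℂ (PmSub k d n) :=
  Module.Finite.iff_fg.mpr (Submodule.fg_pi fun _ => homogeneousSubmodule_fg ..)

lemma DeltaOp_BOp_injective (hk : 0 < k) {A : Fin k → Matrix (Fin d) (Fin d) ℂ}
    (hell : elliptic A) : Function.Injective (DeltaOp A ∘ₗ BOp A) := by
  rw [injective_iff_map_eq_zero]
  intro q hq
  refine (map_eq_zero_iff _ (BOp_injective hk hell)).mp (eq_zero_of_fischer_self ?_)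
  rw [fischer_BOp_right, ← LinearMap.comp_apply, hq]
  simp [fischer]

lemma exists_harmonic_add_BOp (hk : 0 < k) {A : Fin k → Matrix (Fin d) (Fin d) ℂ}
    (hell : elliptic A) {n : ℕ} {p : VPoly k d} (hp : IsHomV (n + 2) p) :
    ∃ h q : VPoly k d, IsHomV (n + 2) h ∧ DeltaOp A h = 0 ∧ IsHomV n q ∧ p = h + BOp A q := by
  have hmaps : ∀ q ∈ PmSub k d n, (DeltaOp A ∘ₗ BOp A) q ∈ PmSub k d n := fun q hq =>
    mem_PmSub.mpr (((mem_PmSub.mp hq).BOp A).DeltaOp A)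
  have hsurj := LinearMap.surjective_of_injective
    (f := (DeltaOp A ∘ₗ BOp A).restrict hmaps)
    fun a b hab => Subtype.ext (DeltaOp_BOp_injective hk hell (congrArg Subtype.val hab))
  obtain ⟨⟨q, hq⟩, hqp⟩ := hsurj ⟨DeltaOp A p, mem_PmSub.mpr (hp.DeltaOp A)⟩
  have hqp' : DeltaOp A (BOp A q) = DeltaOp A p := congrArg Subtype.val hqp
  have hq' := mem_PmSub.mp hq
  refine ⟨p - BOp A q, q, fun r => (hp r).sub (hq'.BOp A r), ?_, hq', (sub_add_cancel _ _).symm⟩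
  rw [map_sub, hqp', sub_self]

lemma sum_range_succ_iterate_BOp (A : Fin k → Matrix (Fin d) (Fin d) ℂ) (h : ℕ → VPoly k d)
    (N : ℕ) : ∑ j ∈ Finset.range (N + 1), (BOp A)^[j] (h j) =
      h 0 + BOp A (∑ j ∈ Finset.range N, (BOp A)^[j] (h (j + 1))) := by
  simp [Finset.sum_range_succ', add_comm, map_sum, Function.iterate_succ_apply']

lemma exists_iterate_BOp_decomposition (hk : 0 < k) {A : Fin k → Matrix (Fin d) (Fin d) ℂ}
    (hell : elliptic A) (m : ℕ) {p : VPoly k d} (hp : IsHomV m p) :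
    ∃ h : ℕ → VPoly k d,
      (∀ j ∈ Finset.range (m / 2 + 1), IsHomV (m - 2 * j) (h j) ∧ DeltaOp A (h j) = 0) ∧
      p = ∑ j ∈ Finset.range (m / 2 + 1), (BOp A)^[j] (h j) := by
  induction m using Nat.twoStepInduction generalizing p with
  | zero => exact ⟨fun _ => p, by simp [hp, DeltaOp_eq_zero_of_isHomV two_pos hp], by simp⟩
  | one => exact ⟨fun _ => p, by simp [hp, DeltaOp_eq_zero_of_isHomV one_lt_two hp], by simp⟩
  | more n ih _ =>
    obtain ⟨h₀, q, hh₀, hΔ, hq, rfl⟩ := exists_harmonic_add_BOp hk hell hp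
    obtain ⟨h, hh, rfl⟩ := ih hq
    refine ⟨fun j => Nat.casesOn j h₀ h, fun j hj => ?_, ?_⟩
    · cases j with
      | zero => exact ⟨hh₀, hΔ⟩
      | succ j =>
        rw [show n + 2 - 2 * (j + 1) = n - 2 * j by omega]
        exact hh j (by simp only [Finset.mem_range] at hj ⊢; omega)
    · rw [Nat.add_div_right n two_pos, sum_range_succ_iterate_BOp A _ (n / 2 + 1)]
      rfl

lemma eq_zero_of_sum_iterate_BOp_eq_zero (hk : 0 < k) {A : Fin k → Matrix (Fin d) (Fin d) ℂ}
    (hell : elliptic A) (N : ℕ) {h : ℕ → VPoly k d} (hh : ∀ j < N, DeltaOp A (h j) = 0)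
    (hsum : ∑ j ∈ Finset.range N, (BOp A)^[j] (h j) = 0) : ∀ j < N, h j = 0 := by
  induction N generalizing h with
  | zero => simp
  | succ N ih =>
    rw [sum_range_succ_iterate_BOp] at hsum
    set w := ∑ j ∈ Finset.range N, (BOp A)^[j] (h (j + 1))
    have h₀ : h 0 = 0 := by
      refine eq_zero_of_fischer_self ?_
      have hw : h 0 = BOp A (-w) := by rw [map_neg]; exact eq_neg_of_add_eq_zero_left hsum
      calc fischer (h 0) (h 0) = fischer (h 0) (BOp A (-w)) := congrArg _ hw
        _ = fischer 0 (-w) := by rw [fischer_BOp_right, hh 0 N.succ_pos]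
        _ = 0 := by simp [fischer]
    rw [h₀, zero_add, map_eq_zero_iff _ (BOp_injective hk hell)] at hsum
    have hs := ih (h := fun j => h (j + 1)) (fun j hj => hh _ (by omega)) hsum
    intro j hj
    cases j with
    | zero => exact h₀
    | succ j => exact hs j (by omega)

end FischerDecomposition

/-- For `m ≥ 2`, `P_m` is the orthogonal direct sum (for the Fischer inner
product) of `H_m = P_m ∩ ker Δ` and `B(x)·P_{m−2}`; consequently
`P_m = ⊕_{j=0}^{⌊m/2⌋} B(x)^j · H_{m−2j}`. -/
theorem fischer_orthogonal_decomposition (k d : ℕ) (hk : 2 ≤ k) (hd : 1 ≤ d)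
    (A : Fin k → Matrix (Fin d) (Fin d) ℂ)
    (hinv : ∀ j, IsUnit (A j))
    (hell : elliptic A)
    (m : ℕ) (hm : 2 ≤ m) :
    -- spanning: every `p ∈ P_m` is a sum of an element of `H_m` and an element of `B·P_{m−2}`
    (∀ p : VPoly k d, IsHomV m p →
      ∃ h q : VPoly k d, IsHomV m h ∧ DeltaOp A h = 0 ∧ IsHomV (m - 2) q ∧
        p = h + BOp A q) ∧
    -- orthogonality of `H_m` and `B·P_{m−2}` with respect to the Fischer inner product
    (∀ h q : VPoly k d, IsHomV m h → DeltaOp A h = 0 → IsHomV (m - 2) q →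
      fischer h (BOp A q) = 0) ∧
    -- consequently, `P_m = ⊕_{j=0}^{⌊m/2⌋} B(x)^j · H_{m−2j}` : existence of the decomposition …
    (∀ p : VPoly k d, IsHomV m p →
      ∃ h : ℕ → VPoly k d,
        (∀ j ∈ Finset.range (m / 2 + 1),
          IsHomV (m - 2 * j) (h j) ∧ DeltaOp A (h j) = 0) ∧
        p = ∑ j ∈ Finset.range (m / 2 + 1), (BOp A)^[j] (h j)) ∧
    -- … and directness of the sum
    (∀ h : ℕ → VPoly k d,
      (∀ j ∈ Finset.range (m / 2 + 1),
        IsHomV (m - 2 * j) (h j) ∧ DeltaOp A (h j) = 0) →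
      ∑ j ∈ Finset.range (m / 2 + 1), (BOp A)^[j] (h j) = 0 →
      ∀ j ∈ Finset.range (m / 2 + 1), (BOp A)^[j] (h j) = 0) := by
  have hk₀ : 0 < k := by omega
  refine ⟨fun p hp => ?_, fun h q _ hΔ _ => ?_,
    fun p hp => exists_iterate_BOp_decomposition hk₀ hell m hp, fun h hh hsum j hj => ?_⟩
  · obtain ⟨n, rfl⟩ := Nat.exists_eq_add_of_le' hm
    exact exists_harmonic_add_BOp hk₀ hell hp
  · rw [fischer_BOp_right, hΔ]
    simp [fischer]
  · rw [eq_zero_of_sum_iterate_BOp_eq_zero hk₀ hell _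
      (fun j hj => (hh j (Finset.mem_range.mpr hj)).2) hsum j (Finset.mem_range.mp hj),
      iterate_map_zero]

end
end

section
/- Let k ≥ 2 and d ≥ 1 be integers, let A_1, …, A_k be invertible d×d complex matrices satisfying the ellipticity condition, and let R denote the restriction map sending a ℂ^d-valued polynomial p on ℝ^k to its restriction p|_{S^{k−1}} to the unit sphere. Then for every integer m ≥ 0, R(P_m) = R(H_m) + R(H_{m−2}) + ⋯ + R(H_{m−2⌊m/2⌋}), and this sum of subspaces is direct (the subspaces R(H_m), R(H_{m−2}), …, R(H_{m−2⌊m/2⌋}) are linearly independent). In particular, every restriction to the sphere of an element of P_m is a sum of restrictions of elements of ker Δ. -/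
open MvPolynomial Matrix

noncomputable section

/-- Restriction of a `ℂ^d`-valued polynomial on `ℝ^k` to the unit sphere `S^{k−1}`. -/
def restrictSphere {k d : ℕ} (p : VPoly k d) :
    Metric.sphere (0 : EuclideanSpace ℝ (Fin k)) 1 → Fin d → ℂ :=
  fun θ r => aeval (fun i => ((θ : EuclideanSpace ℝ (Fin k)) i : ℂ)) (p r)

/-- Evaluation of a complex polynomial at a real point. -/
def evalReal {k : ℕ} (x : Fin k → ℝ) : MvPolynomial (Fin k) ℂ →ₐ[ℂ] ℂ :=
  aeval fun i => (x i : ℂ)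

/-- The polynomial `1 - |x|²`. -/
def sphereDefect (k : ℕ) : MvPolynomial (Fin k) ℂ := 1 - ∑ i, X i ^ 2

theorem evalReal_sphereDefect {k : ℕ} (x : Fin k → ℝ) :
    evalReal x (sphereDefect k) = ((1 - ∑ i, x i ^ 2 : ℝ) : ℂ) := by
  simp [evalReal, sphereDefect]

theorem eq_zero_of_evalReal_eq_zero_on_box {k : ℕ} {f : MvPolynomial (Fin k) ℂ} {δ : ℝ}
    (hδ : 0 < δ) (h : ∀ x : Fin k → ℝ, (∀ i, x i ∈ Set.Ioo 0 δ) → evalReal x f = 0) : f = 0 := by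
  refine funext_set (fun _ => (fun t : ℝ => (t : ℂ)) '' Set.Ioo 0 δ)
    (fun _ => (Set.Ioo_infinite hδ).image Complex.ofReal_injective.injOn) fun z hz => ?_
  choose x hx hxz using fun i => hz i trivial
  have := h x hx
  rw [evalReal, show (fun i => (x i : ℂ)) = z from funext hxz] at this
  rw [map_zero, ← this]
  rfl

theorem MvPolynomial.IsHomogeneous.aeval_smul {σ R S : Type*} [CommSemiring R] [CommSemiring S]
    [Algebra R S] {n : ℕ} {f : MvPolynomial σ R} (hf : f.IsHomogeneous n) (c : S) (x : σ → S) :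
    MvPolynomial.aeval (fun i => c * x i) f = c ^ n * MvPolynomial.aeval x f := by
  simp only [aeval_def, eval₂_eq, Finset.mul_sum]
  refine Finset.sum_congr rfl fun s hs => ?_
  have : ∑ i ∈ s.support, s i = n := (hf.degree_eq_sum_deg_support hs).symm
  simp only [mul_pow, Finset.prod_mul_distrib, Finset.prod_pow_eq_pow_sum, this]
  ring

theorem evalReal_smul {k n : ℕ} {f : MvPolynomial (Fin k) ℂ} (hf : f.IsHomogeneous n)
    (c : ℝ) (x : Fin k → ℝ) : evalReal (c • x) f = (c : ℂ) ^ n * evalReal x f := by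
  rw [evalReal, evalReal, ← hf.aeval_smul]
  simp

theorem evalReal_neg {k n : ℕ} {f : MvPolynomial (Fin k) ℂ} (hf : f.IsHomogeneous n)
    (x : Fin k → ℝ) : evalReal (-x) f = (-1) ^ n * evalReal x f := by
  simpa using evalReal_smul hf (-1) x

/-- A homogeneous polynomial vanishing on the real unit sphere is zero. -/
theorem MvPolynomial.IsHomogeneous.eq_zero_of_sphere {k n : ℕ} {f : MvPolynomial (Fin k) ℂ}
    (hf : f.IsHomogeneous n)
    (h : ∀ x : Fin k → ℝ, ∑ i, x i ^ 2 = 1 → evalReal x f = 0) (hk : 0 < k) : f = 0 := by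
  refine eq_zero_of_evalReal_eq_zero_on_box one_pos fun x hx => ?_
  have hpos : 0 < ∑ i, x i ^ 2 :=
    Finset.sum_pos (fun i _ => pow_pos (hx i).1 2) ⟨⟨0, hk⟩, Finset.mem_univ _⟩
  set s := √(∑ i, x i ^ 2) with hs
  have hs0 : s ≠ 0 := (Real.sqrt_pos.2 hpos).ne'
  have hss : s ^ 2 = ∑ i, x i ^ 2 := Real.sq_sqrt hpos.le
  have hx' : x = s • s⁻¹ • x := by rw [smul_smul, mul_inv_cancel₀ hs0, one_smul]
  rw [hx', evalReal_smul hf, h, mul_zero]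
  simp only [Pi.smul_apply, smul_eq_mul, mul_pow, ← Finset.mul_sum, ← hss, inv_pow]
  exact inv_mul_cancel₀ (pow_ne_zero 2 hs0)

theorem sum_homogeneousComponent_of_le {σ R : Type*} [CommSemiring R] {f : MvPolynomial σ R}
    {m : ℕ} (hm : f.totalDegree ≤ m) :
    ∑ n ∈ Finset.range (m + 1), homogeneousComponent n f = f := by
  conv_rhs => rw [← sum_homogeneousComponent f]
  refine (Finset.sum_subset (by simpa using hm) fun n _ hn => ?_).symm
  exact homogeneousComponent_eq_zero _ _ (by simpa using hn)

/-- The part of given parity of a polynomial takes the values `f x + (-1) ^ m * f (-x)`. -/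
theorem evalReal_parity_sum {k m : ℕ} {f : MvPolynomial (Fin k) ℂ} (hm : f.totalDegree ≤ m)
    (x : Fin k → ℝ) :
    ∑ n ∈ Finset.range (m + 1), (1 + (-1) ^ (m + n)) * evalReal x (homogeneousComponent n f) =
      evalReal x f + (-1) ^ m * evalReal (-x) f := by
  conv_rhs => rw [← sum_homogeneousComponent_of_le hm]
  simp only [map_sum, Finset.mul_sum, ← Finset.sum_add_distrib,
    evalReal_neg (homogeneousComponent_isHomogeneous _ f)]
  refine Finset.sum_congr rfl fun n _ => ?_
  ring

theorem isHomogeneous_sum_X_sq (k : ℕ) :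
    (∑ i, X i ^ 2 : MvPolynomial (Fin k) ℂ).IsHomogeneous 2 :=
  IsHomogeneous.sum _ _ _ fun i _ => isHomogeneous_X_pow i 2

theorem sphereDefect_dvd_sub_pow_mul {k : ℕ} (j : ℕ) (f : MvPolynomial (Fin k) ℂ) :
    sphereDefect k ∣ f - (∑ i, X i ^ 2) ^ j * f := by
  rw [← one_sub_mul]
  exact (one_sub_dvd_one_sub_pow _ j).mul_right f

theorem sphereDefect_dvd_parity_sum {k m : ℕ} (hk : 0 < k) {f : MvPolynomial (Fin k) ℂ}
    (hm : f.totalDegree ≤ m) (h : ∀ x : Fin k → ℝ, ∑ i, x i ^ 2 = 1 → evalReal x f = 0) :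
    sphereDefect k ∣
      ∑ n ∈ Finset.range (m + 1), C (1 + (-1) ^ (m + n)) * homogeneousComponent n f := by
  have hF : ∑ n ∈ Finset.range (m + 1), C (1 + (-1) ^ (m + n)) *
      ((∑ i, X i ^ 2) ^ ((m - n) / 2) * homogeneousComponent n f) = 0 := by
    refine IsHomogeneous.eq_zero_of_sphere (n := m) (IsHomogeneous.sum _ _ _ fun n hn => ?_)
      (fun x hx => ?_) hk
    · have hn : n ≤ m := by simpa [Nat.lt_succ_iff] using hn
      rcases Nat.even_or_odd (m + n) with he | ho
      · have : m = 2 * ((m - n) / 2) + n := by grind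
        have h2 := ((isHomogeneous_sum_X_sq k).pow ((m - n) / 2)).mul
          (homogeneousComponent_isHomogeneous n f)
        rw [← this] at h2
        exact h2.C_mul _
      · simp [ho.neg_one_pow, isHomogeneous_zero]
    · have hz : evalReal x f + (-1) ^ m * evalReal (-x) f = 0 := by
        rw [h x hx, h (-x) (by simpa using hx), mul_zero, add_zero]
      rw [map_sum, ← hz, ← evalReal_parity_sum hm]
      refine Finset.sum_congr rfl fun n _ => ?_
      have : evalReal x (∑ i, X i ^ 2) = 1 := by
        simp only [evalReal, map_sum, map_pow, aeval_X]
        exact_mod_cast hx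
      rw [map_mul, map_mul, map_pow, this]
      simp [evalReal]
  rw [← sub_zero (∑ n ∈ _, _), ← hF, ← Finset.sum_sub_distrib]
  refine Finset.dvd_sum fun n _ => ?_
  rw [← mul_sub]
  exact (sphereDefect_dvd_sub_pow_mul _ _).mul_left _

/-- A polynomial vanishing on the real unit sphere is a multiple of `1 - |x|²`. -/
theorem sphereDefect_dvd {k : ℕ} (hk : 0 < k) {f : MvPolynomial (Fin k) ℂ}
    (h : ∀ x : Fin k → ℝ, ∑ i, x i ^ 2 = 1 → evalReal x f = 0) : sphereDefect k ∣ f := by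
  set m := f.totalDegree with hm
  have h1 := sphereDefect_dvd_parity_sum hk hm.ge h
  have h2 := sphereDefect_dvd_parity_sum (m := m + 1) hk (by omega) h
  have h3 := dvd_add h1 h2
  rw [Finset.sum_range_succ _ (m + 1), homogeneousComponent_eq_zero (m + 1) f (by omega), mul_zero,
    add_zero, ← Finset.sum_add_distrib] at h3
  have h4 : ∑ n ∈ Finset.range (m + 1), (C (1 + (-1) ^ (m + n)) * homogeneousComponent n f +
      C (1 + (-1) ^ (m + 1 + n)) * homogeneousComponent n f) = C 2 * f := by
    conv_rhs => rw [← sum_homogeneousComponent_of_le hm.ge, Finset.mul_sum]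
    refine Finset.sum_congr rfl fun n _ => ?_
    rw [← add_mul, ← C_add]
    congr 2
    ring
  rw [h4] at h3
  have := h3.mul_left (C 2⁻¹)
  rwa [← mul_assoc, ← C_mul, inv_mul_cancel₀ two_ne_zero, C_1, one_mul] at this

theorem continuous_evalReal {k : ℕ} (f : MvPolynomial (Fin k) ℂ) :
    Continuous fun x : Fin k → ℝ => evalReal x f :=
  f.continuous_eval.comp (f := fun (x : Fin k → ℝ) i => (x i : ℂ)) (by fun_prop)

theorem hasDerivAt_evalReal_insertNth {n : ℕ} (j : Fin (n + 1)) (y : Fin n → ℝ)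
    (f : MvPolynomial (Fin (n + 1)) ℂ) (t : ℝ) :
    HasDerivAt (fun t : ℝ => evalReal (j.insertNth (α := fun _ => ℝ) t y) f)
      (evalReal (j.insertNth (α := fun _ => ℝ) t y) (pderiv j f)) t := by
  induction f using MvPolynomial.induction_on with
  | C a => simpa [evalReal] using hasDerivAt_const t a
  | add p q hp hq => simpa only [map_add] using hp.fun_add hq
  | mul_X p i hp =>
    have hX : HasDerivAt (fun t : ℝ => evalReal (j.insertNth (α := fun _ => ℝ) t y) (X i))
        (evalReal (j.insertNth (α := fun _ => ℝ) t y) (pderiv j (X i))) t := by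
      rcases Fin.eq_self_or_eq_succAbove j i with rfl | ⟨l, rfl⟩
      · simpa [evalReal] using (hasDerivAt_id t).ofReal_comp
      · simpa [evalReal, pderiv_X_of_ne (Fin.succAbove_ne j l)] using
          hasDerivAt_const t ((y l : ℝ) : ℂ)
    simpa only [map_mul, pderiv_mul, map_add] using hp.fun_mul hX

/-- The closed Euclidean unit ball in `ℝᵏ`. -/
def unitBall (k : ℕ) : Set (Fin k → ℝ) := {x | ∑ i, x i ^ 2 ≤ 1}

theorem mem_unitBall {k : ℕ} {x : Fin k → ℝ} : x ∈ unitBall k ↔ ∑ i, x i ^ 2 ≤ 1 := Iff.rfl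

theorem isCompact_unitBall (k : ℕ) : IsCompact (unitBall k) := by
  refine Metric.isCompact_of_isClosed_isBounded (isClosed_le (by fun_prop) continuous_const)
    (Metric.isBounded_closedBall (x := 0) (r := 1) |>.subset fun x hx => ?_)
  rw [mem_closedBall_zero_iff, pi_norm_le_iff_of_nonneg zero_le_one]
  intro i
  rw [Real.norm_eq_abs, ← sq_le_one_iff_abs_le_one]
  exact (Finset.single_le_sum (f := fun i => x i ^ 2) (fun i _ => sq_nonneg (x i))
    (Finset.mem_univ i)).trans hx

theorem integrableOn_evalReal {k : ℕ} (f : MvPolynomial (Fin k) ℂ) :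
    MeasureTheory.IntegrableOn (fun x => evalReal x f) (unitBall k) :=
  (continuous_evalReal f).continuousOn.integrableOn_compact (isCompact_unitBall k)

/-- Integration of polynomials over the closed unit ball. -/
def ballIntegral (k : ℕ) : MvPolynomial (Fin k) ℂ →ₗ[ℂ] ℂ where
  toFun f := ∫ x in unitBall k, evalReal x f
  map_add' f g := by
    simp only [map_add]
    exact MeasureTheory.integral_add (integrableOn_evalReal f) (integrableOn_evalReal g)
  map_smul' c f := by
    simp only [map_smul, RingHom.id_apply]
    exact MeasureTheory.integral_smul c _

theorem integral_slice_eq_zero {n : ℕ} (j : Fin (n + 1)) (y : Fin n → ℝ)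
    {f : MvPolynomial (Fin (n + 1)) ℂ}
    (hf : ∀ x : Fin (n + 1) → ℝ, ∑ i, x i ^ 2 = 1 → evalReal x f = 0) :
    ∫ t : ℝ, (unitBall (n + 1)).indicator (fun x => evalReal x (pderiv j f))
      (j.insertNth (α := fun _ => ℝ) t y) = 0 := by
  have hmem (t : ℝ) : ∑ i, (j.insertNth (α := fun _ => ℝ) t y) i ^ 2 = t ^ 2 + ∑ i, y i ^ 2 := by
    simp [Fin.sum_univ_succAbove _ j]
  by_cases hy : ∑ i, y i ^ 2 ≤ 1
  · set s := √(1 - ∑ i, y i ^ 2) with hs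
    have hss : s ^ 2 = 1 - ∑ i, y i ^ 2 := Real.sq_sqrt (by linarith)
    have hs0 : 0 ≤ s := Real.sqrt_nonneg _
    have hind (t : ℝ) : (unitBall (n + 1)).indicator (fun x => evalReal x (pderiv j f))
        (j.insertNth (α := fun _ => ℝ) t y) = (Set.Icc (-s) s).indicator
          (fun t => evalReal (j.insertNth (α := fun _ => ℝ) t y) (pderiv j f)) t := by
      have : j.insertNth (α := fun _ => ℝ) t y ∈ unitBall (n + 1) ↔ t ∈ Set.Icc (-s) s := by
        rw [mem_unitBall, hmem, Set.mem_Icc, ← abs_le, ← sq_le_sq₀ (abs_nonneg t) hs0,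
          sq_abs, hss]
        constructor <;> intro h <;> linarith
      by_cases ht : t ∈ Set.Icc (-s) s
      · rw [Set.indicator_of_mem ht, Set.indicator_of_mem (this.2 ht)]
      · rw [Set.indicator_of_notMem ht, Set.indicator_of_notMem (this.not.2 ht)]
    simp_rw [hind]
    rw [MeasureTheory.integral_indicator measurableSet_Icc, MeasureTheory.integral_Icc_eq_integral_Ioc,
      ← intervalIntegral.integral_of_le (by linarith),
      intervalIntegral.integral_eq_sub_of_hasDerivAt
        (fun t _ => hasDerivAt_evalReal_insertNth j y f t), hf, hf, sub_zero]
    · rw [hmem]; linarith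
    · rw [hmem]; linarith
    · refine Continuous.intervalIntegrable ?_ _ _
      exact (continuous_evalReal _).comp
        (continuous_id.finInsertNth (A := fun _ => ℝ) j continuous_const)
  · refine (MeasureTheory.integral_congr_ae (Filter.Eventually.of_forall fun t => ?_)).trans
      (MeasureTheory.integral_zero _ _)
    refine Set.indicator_of_notMem (fun h => hy ?_) _
    rw [mem_unitBall, hmem] at h
    nlinarith [sq_nonneg t]

theorem ballIntegral_pderiv_eq_zero {k : ℕ} (j : Fin k) {f : MvPolynomial (Fin k) ℂ}
    (hf : ∀ x : Fin k → ℝ, ∑ i, x i ^ 2 = 1 → evalReal x f = 0) :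
    ballIntegral k (pderiv j f) = 0 := by
  obtain ⟨n, rfl⟩ : ∃ n, k = n + 1 := ⟨k - 1, by have := j.2; omega⟩
  have hmeas := (isCompact_unitBall (n + 1)).measurableSet
  have hem := (MeasureTheory.volume_preserving_piFinSuccAbove (fun _ : Fin (n + 1) => ℝ) j).symm
  have hint := (MeasureTheory.integrable_indicator_iff hmeas).2 (integrableOn_evalReal (pderiv j f))
  rw [← hem.integrable_comp_emb (MeasurableEquiv.measurableEmbedding _)] at hint
  change ∫ x in unitBall (n + 1), _ = (0 : ℂ)
  rw [← MeasureTheory.integral_indicator hmeas, ← hem.integral_comp',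
    MeasureTheory.Measure.volume_eq_prod]
  refine (MeasureTheory.integral_prod_symm _ hint).trans ?_
  refine (MeasureTheory.integral_congr_ae (Filter.Eventually.of_forall fun y => ?_)).trans
      (MeasureTheory.integral_zero _ _)
  exact integral_slice_eq_zero j y hf

/-- The polynomial whose values at real points are conjugate to those of `f`. -/
abbrev conjPoly {k : ℕ} : MvPolynomial (Fin k) ℂ →+* MvPolynomial (Fin k) ℂ :=
  MvPolynomial.map (starRingEnd ℂ)

theorem evalReal_conjPoly {k : ℕ} (x : Fin k → ℝ) (f : MvPolynomial (Fin k) ℂ) :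
    evalReal x (conjPoly f) = starRingEnd ℂ (evalReal x f) := by
  induction f using MvPolynomial.induction_on with
  | C a => simp [evalReal]
  | add p q hp hq => simp [hp, hq]
  | mul_X p i hp => simp [evalReal] at hp ⊢; simp [hp]

theorem eq_zero_of_ballIntegral_sq_eq_zero {k d : ℕ} {w : VPoly k d}
    (h : ballIntegral k (∑ s, conjPoly (w s) * w s) = 0) : w = 0 := by
  have hval (x : Fin k → ℝ) : evalReal x (∑ s, conjPoly (w s) * w s) =
      ((∑ s, ‖evalReal x (w s)‖ ^ 2 : ℝ) : ℂ) := by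
    simp [map_sum, evalReal_conjPoly, Complex.conj_mul']
  have hcont : Continuous fun x : Fin k → ℝ => ∑ s, ‖evalReal x (w s)‖ ^ 2 :=
    continuous_finsetSum _ fun s _ => (continuous_evalReal (w s)).norm.pow 2
  change ∫ x in unitBall k, _ = (0 : ℂ) at h
  simp_rw [hval] at h
  rw [integral_complex_ofReal, Complex.ofReal_eq_zero,
    MeasureTheory.setIntegral_eq_zero_iff_of_nonneg_ae
      (Filter.Eventually.of_forall fun x => Finset.sum_nonneg fun s _ => sq_nonneg _)
      (hcont.continuousOn.integrableOn_compact (isCompact_unitBall k))] at h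
  have hopen : IsOpen {x : Fin k → ℝ | ∑ i, x i ^ 2 < 1} :=
    isOpen_lt (by fun_prop) continuous_const
  have hsub : {x : Fin k → ℝ | ∑ i, x i ^ 2 < 1} ⊆ unitBall k := fun x hx =>
    mem_unitBall.2 (le_of_lt hx)
  have hzero := MeasureTheory.Measure.eqOn_open_of_ae_eq
    (MeasureTheory.ae_restrict_of_ae_restrict_of_subset hsub h)
    hopen hcont.continuousOn continuousOn_const
  ext1 s
  have hδ : (0 : ℝ) < (k + 1 : ℝ)⁻¹ := by positivity
  refine eq_zero_of_evalReal_eq_zero_on_box hδ fun x hx => ?_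
  have hx1 : ∑ i, x i ^ 2 < 1 := by
    calc ∑ i, x i ^ 2 ≤ ∑ i : Fin k, (k + 1 : ℝ)⁻¹ := Finset.sum_le_sum fun i _ => by
          have h1 : (k + 1 : ℝ)⁻¹ ≤ 1 := inv_le_one_of_one_le₀ (by linarith [k.cast_nonneg (α := ℝ)])
          nlinarith [(hx i).1, (hx i).2]
      _ = k / (k + 1) := by simp [div_eq_mul_inv]
      _ < 1 := by rw [div_lt_one (by positivity)]; linarith
  have := hzero hx1
  simp only [Pi.zero_apply] at this
  rw [Finset.sum_eq_zero_iff_of_nonneg fun s _ => sq_nonneg _] at this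
  simpa using this s (Finset.mem_univ s)

/-- The first order operator `∑ⱼ Aⱼ ∂ⱼ`, of which `DeltaOp A` is the formal square. -/
def dirac {k d : ℕ} (A : Fin k → Matrix (Fin d) (Fin d) ℂ) (u : VPoly k d) : VPoly k d :=
  fun s => ∑ j, ∑ r, C (A j s r) * pderiv j (u r)

theorem deltaOp_apply {k d : ℕ} (A : Fin k → Matrix (Fin d) (Fin d) ℂ) (u : VPoly k d)
    (r : Fin d) :
    DeltaOp A u r = -∑ i, ∑ j, ∑ s, C (((A i)ᴴ * A j) r s) * pderiv i (pderiv j (u s)) := by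
  simp [DeltaOp, LinearMap.sum_apply, smul_eq_C_mul]

theorem deltaOp_eq_dirac {k d : ℕ} (A : Fin k → Matrix (Fin d) (Fin d) ℂ) (u : VPoly k d)
    (r : Fin d) :
    DeltaOp A u r =
      -∑ i, ∑ s, C (starRingEnd ℂ (A i s r)) * pderiv i (dirac A u s) := by
  rw [deltaOp_apply]
  congr 1
  refine Finset.sum_congr rfl fun i _ => ?_
  simp only [dirac, map_sum, pderiv_C_mul, Finset.mul_sum, Matrix.mul_apply,
    Matrix.conjTranspose_apply, Finset.sum_mul, C_mul, mul_assoc]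
  rw [Finset.sum_comm' (t' := Finset.univ) (s' := fun _ => Finset.univ) (by simp)]
  conv_rhs =>
    rw [Finset.sum_comm]
    enter [2, j]
    rw [Finset.sum_comm]
  rw [Finset.sum_comm]
  rfl

theorem dirac_eq_zero_of_deltaOp_eq_zero {k d : ℕ} {A : Fin k → Matrix (Fin d) (Fin d) ℂ}
    {u : VPoly k d}
    (hu : ∀ r, ∀ x : Fin k → ℝ, ∑ i, x i ^ 2 = 1 → evalReal x (u r) = 0)
    (hΔ : DeltaOp A u = 0) : dirac A u = 0 := by
  refine eq_zero_of_ballIntegral_sq_eq_zero ?_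
  have key : ∑ s, conjPoly (dirac A u s) * dirac A u s =
      ∑ i, pderiv i (∑ r, ∑ s, C (starRingEnd ℂ (A i s r)) * (conjPoly (u r) * dirac A u s)) := by
    have h0 : ∑ r, conjPoly (u r) * DeltaOp A u r = 0 := by simp [hΔ]
    have h1 : ∑ r, conjPoly (u r) * DeltaOp A u r = -∑ i, ∑ r, ∑ s,
        C (starRingEnd ℂ (A i s r)) * (conjPoly (u r) * pderiv i (dirac A u s)) := by
      simp only [deltaOp_eq_dirac, mul_neg, Finset.sum_neg_distrib, Finset.mul_sum, mul_left_comm]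
      rw [Finset.sum_comm]
    have h2 (s : Fin d) : conjPoly (dirac A u s) =
        ∑ i, ∑ r, C (starRingEnd ℂ (A i s r)) * pderiv i (conjPoly (u r)) := by
      rw [dirac]
      simp only [map_sum, map_mul, MvPolynomial.map_C, pderiv_map]
    have h3 : ∑ s, conjPoly (dirac A u s) * dirac A u s = ∑ i, ∑ r, ∑ s,
        C (starRingEnd ℂ (A i s r)) * (pderiv i (conjPoly (u r)) * dirac A u s) := by
      simp only [h2, Finset.sum_mul, mul_assoc]
      rw [Finset.sum_comm]
      exact Finset.sum_congr rfl fun i _ => Finset.sum_comm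
    rw [h3, ← sub_zero (∑ i, ∑ r, ∑ s, _), ← h0, h1, sub_neg_eq_add]
    simp only [← Finset.sum_add_distrib, map_sum, pderiv_C_mul]
    refine Finset.sum_congr rfl fun i _ => Finset.sum_congr rfl fun r _ =>
        Finset.sum_congr rfl fun s _ => ?_
    rw [pderiv_mul, mul_add]
  rw [key, map_sum]
  refine Finset.sum_eq_zero fun i _ => ballIntegral_pderiv_eq_zero i fun x hx => ?_
  simp [evalReal_conjPoly, hu _ x hx]

theorem sphereDefect_ne_zero (k : ℕ) : sphereDefect k ≠ 0 := by
  intro h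
  have := evalReal_sphereDefect (0 : Fin k → ℝ)
  simp [h] at this

theorem not_isUnit_sphereDefect {k : ℕ} (hk : 0 < k) : ¬ IsUnit (sphereDefect k) := by
  intro h
  have := h.map (evalReal (Pi.single (⟨0, hk⟩ : Fin k) 1))
  rw [evalReal_sphereDefect] at this
  simp [Pi.single_apply] at this

theorem pderiv_sphereDefect {k : ℕ} (j : Fin k) : pderiv j (sphereDefect k) = -(2 * X j) := by
  simp [sphereDefect, pderiv_X, Pi.single_apply]

theorem dirac_sphereDefect_pow_mul {k d : ℕ} (A : Fin k → Matrix (Fin d) (Fin d) ℂ)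
    (q : VPoly k d) (n : ℕ) (s : Fin d) :
    dirac A (fun r => sphereDefect k ^ (n + 1) * q r) s = sphereDefect k ^ n *
      (sphereDefect k * dirac A q s - 2 * (n + 1) * ∑ r, (∑ j, C (A j s r) * X j) * q r) := by
  have : ∑ r, (∑ j, C (A j s r) * X j) * q r = ∑ j, ∑ r, C (A j s r) * X j * q r := by
    simp only [Finset.sum_mul]
    exact Finset.sum_comm
  simp only [this, dirac, pderiv_mul, pderiv_pow, pderiv_sphereDefect, Finset.mul_sum,
    ← Finset.sum_sub_distrib]
  refine Finset.sum_congr rfl fun j _ => Finset.sum_congr rfl fun r _ => ?_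
  rw [show n + 1 - 1 = n from rfl]
  push_cast
  ring

theorem sphereDefect_pow_succ_dvd {k d : ℕ} (hk : 0 < k) {A : Fin k → Matrix (Fin d) (Fin d) ℂ}
    (hell : elliptic A) {q : VPoly k d} {n : ℕ}
    (hD : dirac A (fun r => sphereDefect k ^ (n + 1) * q r) = 0) (r : Fin d) :
    sphereDefect k ∣ q r := by
  refine sphereDefect_dvd hk fun x hx => ?_
  have hdet : IsUnit (∑ j, (x j : ℂ) • A j).det := by
    refine isUnit_iff_ne_zero.2 fun h => ?_
    have := hell x h
    simp [this] at hx
  have hmul : (∑ j, (x j : ℂ) • A j) *ᵥ (fun r => evalReal x (q r)) = 0 := by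
    ext1 s
    have h1 := congrFun hD s
    rw [dirac_sphereDefect_pow_mul, Pi.zero_apply, mul_eq_zero,
      or_iff_right (pow_ne_zero _ (sphereDefect_ne_zero k))] at h1
    have h2 := congrArg (evalReal x) h1
    have h3 : (n : ℂ) + 1 ≠ 0 := n.cast_add_one_ne_zero
    simp only [map_sub, map_mul, evalReal_sphereDefect, hx, sub_self, Complex.ofReal_zero, zero_mul,
      zero_sub, map_zero, neg_eq_zero, map_add, map_one, map_natCast, map_ofNat, mul_eq_zero, h3,
      OfNat.ofNat_ne_zero, false_or] at h2
    rw [Pi.zero_apply, ← h2]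
    simp [evalReal, Matrix.mulVec, dotProduct, Matrix.sum_apply, mul_comm]
  exact congrFun (Matrix.eq_zero_of_mulVec_eq_zero hdet.ne_zero hmul) r

/-- A polynomial solution of the Dirichlet problem with zero data in the ball vanishes. -/
theorem eq_zero_of_deltaOp_eq_zero {k d : ℕ} (hk : 0 < k)
    {A : Fin k → Matrix (Fin d) (Fin d) ℂ} (hell : elliptic A) {u : VPoly k d}
    (hu : ∀ r, ∀ x : Fin k → ℝ, ∑ i, x i ^ 2 = 1 → evalReal x (u r) = 0)
    (hΔ : DeltaOp A u = 0) : u = 0 := by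
  have hD := dirac_eq_zero_of_deltaOp_eq_zero hu hΔ
  have hdvd (n : ℕ) : ∀ r, sphereDefect k ^ (n + 1) ∣ u r := by
    induction n with
    | zero => simpa using fun r => sphereDefect_dvd hk (hu r)
    | succ n ih =>
      choose q hq using ih
      obtain rfl : u = fun r => sphereDefect k ^ (n + 1) * q r := funext hq
      intro r
      rw [pow_succ]
      exact mul_dvd_mul_left _ (sphereDefect_pow_succ_dvd hk hell hD r)
  ext1 r
  by_contra hr
  obtain ⟨n, hn⟩ := FiniteMultiplicity.of_not_isUnit (not_isUnit_sphereDefect hk) hr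
  exact hn (hdvd n r)

theorem MvPolynomial.totalDegree_pderiv_le {σ R : Type*} [CommSemiring R] (i : σ)
    (f : MvPolynomial σ R) : (pderiv i f).totalDegree ≤ f.totalDegree - 1 := by
  refine Finset.sup_le fun s hs => ?_
  have hs' : s + Finsupp.single i 1 ∈ f.support := by
    rw [mem_support_iff] at hs ⊢
    exact fun h => hs (by rw [coeff_pderiv, h, zero_mul])
  have := le_totalDegree hs'
  rw [Finsupp.sum_add_index' (fun _ => rfl) (fun _ _ _ => rfl), Finsupp.sum_single_index rfl] at this
  omega

theorem pderiv_pderiv_eq_zero {σ R : Type*} [CommSemiring R] (i j : σ) {f : MvPolynomial σ R}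
    (hf : f.totalDegree ≤ 1) : pderiv i (pderiv j f) = 0 := by
  have h0 : (pderiv j f).totalDegree = 0 := by
    have := totalDegree_pderiv_le j f
    omega
  rw [totalDegree_eq_zero_iff_eq_C.1 h0, pderiv_C]

theorem pderiv_homogeneousComponent_succ {σ R : Type*} [CommSemiring R] (i : σ) (n : ℕ)
    (f : MvPolynomial σ R) :
    pderiv i (homogeneousComponent (n + 1) f) = homogeneousComponent n (pderiv i f) := by
  ext s
  rw [coeff_pderiv, coeff_homogeneousComponent, coeff_homogeneousComponent, coeff_pderiv]
  simp only [map_add, Finsupp.degree_single, Nat.add_right_cancel_iff]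
  split_ifs <;> simp

theorem deltaOp_eq_zero_of_totalDegree_le_one {k d : ℕ} (A : Fin k → Matrix (Fin d) (Fin d) ℂ)
    {u : VPoly k d} (hu : ∀ r, (u r).totalDegree ≤ 1) : DeltaOp A u = 0 := by
  ext1 r
  simp [deltaOp_apply, pderiv_pderiv_eq_zero _ _ (hu _)]

theorem deltaOp_homogeneousComponent {k d : ℕ} {A : Fin k → Matrix (Fin d) (Fin d) ℂ}
    {u : VPoly k d} (hu : DeltaOp A u = 0) (n : ℕ) :
    DeltaOp A (fun r => homogeneousComponent n (u r)) = 0 := by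
  rcases Nat.lt_or_ge n 2 with hn | hn
  · exact deltaOp_eq_zero_of_totalDegree_le_one A fun r =>
      (homogeneousComponent_isHomogeneous n (u r)).totalDegree_le.trans (by omega)
  · obtain ⟨n, rfl⟩ := Nat.exists_eq_add_of_le' hn
    ext1 r
    have h := congrArg (homogeneousComponent n) (congrFun hu r)
    rw [Pi.zero_apply, map_zero, deltaOp_apply] at h
    rw [Pi.zero_apply, ← h, deltaOp_apply]
    simp only [map_neg, map_sum, homogeneousComponent_C_mul, ← pderiv_homogeneousComponent_succ]

theorem totalDegree_deltaOp_le {k d m : ℕ} (A : Fin k → Matrix (Fin d) (Fin d) ℂ)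
    {u : VPoly k d} (hu : ∀ r, (u r).totalDegree ≤ m + 2) (r : Fin d) :
    DeltaOp A u r ∈ restrictTotalDegree (Fin k) ℂ m := by
  rw [deltaOp_apply]
  refine neg_mem (sum_mem fun i _ => sum_mem fun j _ => sum_mem fun s _ => ?_)
  rw [← smul_eq_C_mul]
  refine Submodule.smul_mem _ _ ?_
  rw [mem_restrictTotalDegree]
  have h1 := totalDegree_pderiv_le i (pderiv j (u s))
  have h2 := totalDegree_pderiv_le j (u s)
  have h3 := hu s
  omega

theorem totalDegree_sphereDefect_mul_le {k m : ℕ} {f : MvPolynomial (Fin k) ℂ}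
    (hf : f.totalDegree ≤ m) : (sphereDefect k * f).totalDegree ≤ m + 2 := by
  have h1 : (sphereDefect k).totalDegree ≤ 2 :=
    (totalDegree_sub _ _).trans (by simpa using (isHomogeneous_sum_X_sq k).totalDegree_le)
  exact (totalDegree_mul _ _).trans (by omega)

/-- Solvability of the inhomogeneous Dirichlet problem in the ball for polynomial data. -/
theorem exists_deltaOp_sphereDefect_mul_eq {k d : ℕ} (hk : 0 < k)
    {A : Fin k → Matrix (Fin d) (Fin d) ℂ} (hell : elliptic A) {m : ℕ} {g : VPoly k d}
    (hg : ∀ r, (g r).totalDegree ≤ m) :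
    ∃ q : VPoly k d, (∀ r, (q r).totalDegree ≤ m) ∧
      DeltaOp A (fun r => sphereDefect k * q r) = g := by
  let V := restrictTotalDegree (Fin k) ℂ m
  let T : (Fin d → V) →ₗ[ℂ] (Fin d → V) := LinearMap.pi fun r =>
    LinearMap.codRestrict V (LinearMap.proj r ∘ₗ DeltaOp A ∘ₗ
      ((LinearMap.mulLeft ℂ (sphereDefect k)).compLeft (Fin d)) ∘ₗ (V.subtype.compLeft (Fin d)))
      fun q => totalDegree_deltaOp_le A
        (fun r => totalDegree_sphereDefect_mul_le ((mem_restrictTotalDegree _ _ _).1 (q r).2)) r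
  have hT (q : Fin d → V) (r : Fin d) :
      (T q r : MvPolynomial (Fin k) ℂ) = DeltaOp A (fun r => sphereDefect k * q r) r := rfl
  have hinj : Function.Injective T := by
    refine (injective_iff_map_eq_zero T).2 fun q hq => ?_
    have h0 := eq_zero_of_deltaOp_eq_zero hk hell (u := fun r => sphereDefect k * q r)
      (fun r x hx => by simp [evalReal_sphereDefect, hx])
      (funext fun r => by rw [← hT, hq]; rfl)
    ext1 r
    exact Subtype.ext ((mul_eq_zero.1 (congrFun h0 r)).resolve_left (sphereDefect_ne_zero k))
  obtain ⟨q, hq⟩ := LinearMap.surjective_of_injective hinj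
    fun r => ⟨g r, (mem_restrictTotalDegree _ _ _).2 (hg r)⟩
  exact ⟨fun r => q r, fun r => (mem_restrictTotalDegree _ _ _).1 (q r).2,
    funext fun r => by rw [← hT, hq]⟩

/-- Every vector polynomial agrees on the sphere with a polynomial in the kernel of `DeltaOp A`
of no larger degree. -/
theorem exists_deltaOp_eq_zero_eq_on_sphere {k d : ℕ} (hk : 0 < k)
    {A : Fin k → Matrix (Fin d) (Fin d) ℂ} (hell : elliptic A) {m : ℕ} {p : VPoly k d}
    (hp : ∀ r, (p r).totalDegree ≤ m) :
    ∃ u : VPoly k d, (∀ r, (u r).totalDegree ≤ m) ∧ DeltaOp A u = 0 ∧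
      ∀ r, ∀ x : Fin k → ℝ, ∑ i, x i ^ 2 = 1 → evalReal x (u r) = evalReal x (p r) := by
  rcases Nat.lt_or_ge m 2 with hm | hm
  · exact ⟨p, hp, deltaOp_eq_zero_of_totalDegree_le_one A fun r => (hp r).trans (by omega),
      fun _ _ _ => rfl⟩
  · obtain ⟨m, rfl⟩ := Nat.exists_eq_add_of_le' hm
    obtain ⟨q, hq, hqp⟩ := exists_deltaOp_sphereDefect_mul_eq hk hell
      fun r => (mem_restrictTotalDegree _ _ _).1 (totalDegree_deltaOp_le A hp r)
    refine ⟨p - fun r => sphereDefect k * q r, fun r => (totalDegree_sub _ _).trans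
      (max_le (hp r) (totalDegree_sphereDefect_mul_le (hq r))), ?_, fun r x hx => ?_⟩
    · rw [map_sub, hqp]
      exact sub_self _
    · simp [evalReal_sphereDefect, hx]

theorem sum_parity {R : Type*} [CommRing R] (m : ℕ) (g : ℕ → R) :
    ∑ n ∈ Finset.range (m + 1), (1 + (-1) ^ (m + n)) * g n =
      2 * ∑ j ∈ Finset.range (m / 2 + 1), g (m - 2 * j) := by
  rw [Finset.mul_sum]
  refine (Finset.sum_of_injOn (fun j => m - 2 * j) ?_ ?_ ?_ ?_).symm
  · intro a ha b hb hab
    simp only [Finset.coe_range, Set.mem_Iio] at ha hb hab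
    omega
  · intro a ha
    simp only [Finset.coe_range, Set.mem_Iio] at ha ⊢
    omega
  · intro n hn hn'
    have hodd : Odd (m + n) := by
      by_contra h
      refine hn' ⟨(m - n) / 2, ?_⟩
      simp only [Finset.mem_range, Finset.coe_range, Set.mem_Iio] at hn ⊢
      grind
    simp [hodd.neg_one_pow]
  · intro j hj
    have : Even (m + (m - 2 * j)) := by
      simp only [Finset.mem_range] at hj
      grind
    rw [this.neg_one_pow, one_add_one_eq_two]

theorem restrictSphere_eq_iff {k d : ℕ} {p q : VPoly k d} :
    restrictSphere p = restrictSphere q ↔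
      ∀ r, ∀ x : Fin k → ℝ, ∑ i, x i ^ 2 = 1 → evalReal x (p r) = evalReal x (q r) := by
  constructor
  · intro h r x hx
    have hmem : WithLp.toLp 2 x ∈ Metric.sphere (0 : EuclideanSpace ℝ (Fin k)) 1 := by
      simp [EuclideanSpace.norm_eq, hx]
    exact congrFun (congrFun h ⟨_, hmem⟩) r
  · intro h
    funext θ r
    refine h r (fun i => (θ : EuclideanSpace ℝ (Fin k)) i) ?_
    have := θ.2
    rw [mem_sphere_zero_iff_norm, EuclideanSpace.norm_eq, Real.sqrt_eq_one] at this
    simpa using this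

theorem restrictSphere_sum {k d : ℕ} {ι : Type*} (s : Finset ι) (h : ι → VPoly k d) :
    restrictSphere (∑ j ∈ s, h j) = ∑ j ∈ s, restrictSphere (h j) := by
  funext θ r
  simp [restrictSphere, Finset.sum_apply]

theorem restrictSphere_zero {k d : ℕ} : restrictSphere (0 : VPoly k d) = 0 := by
  funext θ r
  simp [restrictSphere]

/-- The restrictions to the unit sphere satisfy
`R(P_m) = R(H_m) + R(H_{m−2}) + ⋯ + R(H_{m−2⌊m/2⌋})`, and this sum of subspaces is direct. -/
theorem sphere_restriction_decomposition (k d : ℕ) (hk : 2 ≤ k) (hd : 1 ≤ d)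
    (A : Fin k → Matrix (Fin d) (Fin d) ℂ)
    (hinv : ∀ j, IsUnit (A j))
    (hell : elliptic A)
    (m : ℕ) :
    -- `R(P_m) = R(H_m) + R(H_{m−2}) + ⋯ + R(H_{m−2⌊m/2⌋})` as sets of functions on the sphere
    ({f | ∃ p : VPoly k d, IsHomV m p ∧ f = restrictSphere p} :
        Set (Metric.sphere (0 : EuclideanSpace ℝ (Fin k)) 1 → Fin d → ℂ)) =
      {f | ∃ h : ℕ → VPoly k d,
        (∀ j ∈ Finset.range (m / 2 + 1),
          IsHomV (m - 2 * j) (h j) ∧ DeltaOp A (h j) = 0) ∧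
        f = ∑ j ∈ Finset.range (m / 2 + 1), restrictSphere (h j)} ∧
    -- and the sum of the subspaces `R(H_{m−2j})` is direct
    (∀ h : ℕ → VPoly k d,
      (∀ j ∈ Finset.range (m / 2 + 1),
        IsHomV (m - 2 * j) (h j) ∧ DeltaOp A (h j) = 0) →
      ∑ j ∈ Finset.range (m / 2 + 1), restrictSphere (h j) = 0 →
      ∀ j ∈ Finset.range (m / 2 + 1), restrictSphere (h j) = 0) := by
  have hk0 : 0 < k := by omega
  refine ⟨Set.Subset.antisymm ?_ ?_, fun h hh hsum j hj => ?_⟩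
  · rintro f ⟨p, hp, rfl⟩
    obtain ⟨u, hu, hΔ, hup⟩ := exists_deltaOp_eq_zero_eq_on_sphere hk0 hell
      fun r => (hp r).totalDegree_le
    refine ⟨fun j r => homogeneousComponent (m - 2 * j) (u r), fun j _ =>
      ⟨fun r => homogeneousComponent_isHomogeneous _ _, deltaOp_homogeneousComponent hΔ _⟩, ?_⟩
    rw [← restrictSphere_sum, restrictSphere_eq_iff]
    intro r x hx
    have h1 := evalReal_parity_sum (hu r) x
    rw [sum_parity m fun n => evalReal x (homogeneousComponent n (u r)), hup r x hx,
      hup r (-x) (by simpa using hx), evalReal_neg (hp r), ← mul_assoc, ← mul_pow,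
      neg_one_mul, neg_neg, one_pow, one_mul, ← two_mul] at h1
    rw [← mul_left_cancel₀ two_ne_zero h1, Finset.sum_apply, map_sum]
  · rintro f ⟨h, hh, rfl⟩
    refine ⟨∑ j ∈ Finset.range (m / 2 + 1), fun r => (∑ i, X i ^ 2) ^ j * h j r, fun r => ?_, ?_⟩
    · rw [Finset.sum_apply]
      refine IsHomogeneous.sum _ _ _ fun j hj => ?_
      have hdeg := ((isHomogeneous_sum_X_sq k).pow j).mul ((hh j hj).1 r)
      rw [Finset.mem_range] at hj
      rwa [show 2 * j + (m - 2 * j) = m by omega] at hdeg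
    · rw [restrictSphere_sum]
      refine Finset.sum_congr rfl fun j _ => restrictSphere_eq_iff.2 fun r x hx => ?_
      have hone : evalReal x (∑ i, X i ^ 2) = 1 := by
        simp only [evalReal, map_sum, map_pow, aeval_X]
        exact_mod_cast hx
      rw [map_mul, map_pow, hone, one_pow, one_mul]
  · rw [← restrictSphere_sum, ← restrictSphere_zero, restrictSphere_eq_iff] at hsum
    have hzero := eq_zero_of_deltaOp_eq_zero hk0 hell
      (fun r x hx => (hsum r x hx).trans (map_zero _))
      (by rw [map_sum]; exact Finset.sum_eq_zero fun j hj => (hh j hj).2)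
    have hj0 : h j = 0 := by
      ext1 r
      have hcomp := congrArg (homogeneousComponent (m - 2 * j)) (congrFun hzero r)
      rw [Finset.sum_apply, map_sum, Finset.sum_eq_single_of_mem j hj fun l hl hlj => ?_,
        homogeneousComponent_eq_self ((hh j hj).1 r), Pi.zero_apply, map_zero] at hcomp
      · exact hcomp
      · rw [homogeneousComponent_of_mem ((hh l hl).1 r), if_neg]
        rw [Finset.mem_range] at hj hl
        omega
    rw [hj0, restrictSphere_zero]

end
end
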